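/- Let λ ∈ ℝⁿ satisfy λ_1 ≥ λ_2 ≥ ⋯ ≥ λ_n ≥ 0, let y ∈ ℝⁿ, and let π be a signed permutation matrix with πy = |y|^↓. If u minimizes the function x ↦ ½‖x − πy‖² + ⟨λ, x⟩ over the cone K = {x ∈ ℝⁿ : x_1 ≥ x_2 ≥ ⋯ ≥ x_n ≥ 0}, then π⁻¹u minimizes the function x ↦ ½‖x − y‖² + κ_λ(x) over all of ℝⁿ. -/

import Mathlib

open Matrix

/-- `absDown x` is the vector of the absolute values of the entries of `x`
arranged in non-increasing order, i.e. `|x|^↓`. -/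
noncomputable def absDown {n : ℕ} (x : Fin n → ℝ) : Fin n → ℝ :=
  fun i => |x (Tuple.sort (fun k => -|x k|) i)|

/-- The decreasing weighted sorted ℓ₁ (DWSL1) function `κ_λ(x) = ∑ λ_i |x|_i^↓`. -/
noncomputable def kappa {n : ℕ} (lam x : Fin n → ℝ) : ℝ :=
  ∑ i, lam i * absDown x i

/-- A signed permutation matrix: exactly one nonzero entry in each row and
each column, and every entry is `0`, `1` or `-1`. -/
def IsSignedPerm {n : ℕ} (π : Matrix (Fin n) (Fin n) ℝ) : Prop :=
  (∀ i, ∃! j, π i j ≠ 0) ∧ (∀ j, ∃! i, π i j ≠ 0) ∧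
    ∀ i j, π i j = 0 ∨ π i j = 1 ∨ π i j = -1

/-- The matrix `B` with `(Bx)_i = x_i - x_{i+1}` for `i < n-1` and `(Bx)_{n-1} = x_{n-1}`. -/
def Bmat (n : ℕ) : Matrix (Fin n) (Fin n) ℝ :=
  Matrix.of fun i j => if j = i then 1 else if (j : ℕ) = (i : ℕ) + 1 then -1 else 0

/-- `B_Γ`: the submatrix of `B` consisting of the rows indexed by `Γ`. -/
def Brows {n : ℕ} (Γ : Finset (Fin n)) : Matrix {i // i ∈ Γ} (Fin n) ℝ :=
  Matrix.of fun i j => Bmat n i.1 j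

/-- `P = Iₙ - B_Γᵀ (B_Γ B_Γᵀ)⁻¹ B_Γ`. -/
noncomputable def Pmat {n : ℕ} (Γ : Finset (Fin n)) : Matrix (Fin n) (Fin n) ℝ :=
  1 - (Brows Γ)ᵀ * (Brows Γ * (Brows Γ)ᵀ)⁻¹ * Brows Γ

/-- The Euclidean norm on `Fin n → ℝ`. -/
noncomputable def eucNorm {n : ℕ} (x : Fin n → ℝ) : ℝ := Real.sqrt (∑ i, (x i) ^ 2)

/-- Membership in the set `C_λ = {z : ∑_{j ≤ i} |z|_j^↓ ≤ ∑_{j ≤ i} λ_j for all i}`. -/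
def memC {n : ℕ} (lam z : Fin n → ℝ) : Prop :=
  ∀ i : Fin n, ∑ j ∈ Finset.Iic i, absDown z j ≤ ∑ j ∈ Finset.Iic i, lam j

theorem absDown_antitone {n : ℕ} (x : Fin n → ℝ) : Antitone (absDown x) := fun _ _ h =>
  neg_le_neg_iff.mp (Tuple.monotone_sort (fun k => -|x k|) h)

theorem absDown_nonneg {n : ℕ} (x : Fin n → ℝ) (i : Fin n) : 0 ≤ absDown x i :=
  abs_nonneg _

/-- Any antitone rearrangement of the absolute values of `x` is `absDown x`. -/
theorem absDown_eq_of_antitone {n : ℕ} {x u : Fin n → ℝ} (hu : Antitone u)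
    (σ : Equiv.Perm (Fin n)) (h : ∀ i, u i = |x (σ i)|) : absDown x = u := by
  have hm : Monotone ((fun k => -|x k|) ∘ σ) := fun i j hij => by
    simpa [← h] using hu hij
  have key := Tuple.unique_monotone hm (Tuple.monotone_sort fun k => -|x k|)
  funext i
  have hi := congrFun key i
  simp only [Function.comp_apply, neg_inj] at hi
  rw [h i, hi, absDown]

theorem sum_sq_absDown {n : ℕ} (x : Fin n → ℝ) : ∑ i, absDown x i ^ 2 = ∑ i, x i ^ 2 := by
  simp only [absDown, sq_abs]
  exact Equiv.sum_comp (Tuple.sort fun k => -|x k|) fun i => x i ^ 2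

/-- The rearrangement inequality for absolute values. -/
theorem sum_mul_le_sum_absDown_mul {n : ℕ} (x y : Fin n → ℝ) :
    ∑ i, x i * y i ≤ ∑ i, absDown x i * absDown y i := by
  let τ := Tuple.sort fun k => -|x k|
  let ρ := Tuple.sort fun k => -|y k|
  have hmv : Monovary (absDown x) (absDown y) :=
    (absDown_antitone x).monovary (absDown_antitone y)
  calc ∑ i, x i * y i ≤ ∑ i, |x i| * |y i| :=
        Finset.sum_le_sum fun i _ => (le_abs_self _).trans (abs_mul _ _).le
    _ = ∑ i, |x (τ i)| * |y (τ i)| := (Equiv.sum_comp τ fun i => |x i| * |y i|).symm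
    _ = ∑ i, absDown x i * absDown y ((τ.trans ρ.symm) i) := by
        simp [absDown, τ, ρ]
    _ ≤ ∑ i, absDown x i * absDown y i := hmv.sum_mul_comp_perm_le_sum_mul

theorem sum_sq_absDown_sub_le {n : ℕ} (x y : Fin n → ℝ) :
    ∑ i, (absDown x i - absDown y i) ^ 2 ≤ ∑ i, (x i - y i) ^ 2 := by
  have expand : ∀ a b : Fin n → ℝ,
      ∑ i, (a i - b i) ^ 2 = ∑ i, a i ^ 2 - 2 * ∑ i, a i * b i + ∑ i, b i ^ 2 := fun a b => by
    rw [Finset.mul_sum, ← Finset.sum_sub_distrib, ← Finset.sum_add_distrib]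
    exact Finset.sum_congr rfl fun i _ => by ring
  rw [expand, expand, sum_sq_absDown, sum_sq_absDown]
  linarith [sum_mul_le_sum_absDown_mul x y]

namespace IsSignedPerm

variable {n : ℕ} {π : Matrix (Fin n) (Fin n) ℝ}

/-- A signed permutation matrix permutes the coordinates and multiplies them by signs. -/
theorem exists_perm (hπ : IsSignedPerm π) : ∃ (σ : Equiv.Perm (Fin n)) (s : Fin n → ℝ),
    (∀ i, |s i| = 1) ∧ ∀ x i, π.mulVec x i = s i * x (σ i) := by
  obtain ⟨hrow, hcol, hval⟩ := hπ
  choose f hf hfu using hrow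
  have hinj : Function.Injective f := fun i j hij =>
    (hcol (f i)).unique (hf i) (hij ▸ hf j)
  refine ⟨Equiv.ofBijective f (Finite.injective_iff_bijective.mp hinj), fun i => π i (f i),
    fun i => ?_, fun x i => ?_⟩
  · rcases hval i (f i) with h | h | h
    · exact absurd h (hf i)
    · simp [h]
    · simp [h]
  · refine Finset.sum_eq_single (f i) (fun j _ hj => ?_)
      fun h => absurd (Finset.mem_univ _) h
    exact mul_eq_zero_of_left (not_not.mp (mt (hfu i j) hj)) _

theorem isUnit (hπ : IsSignedPerm π) : IsUnit π := by
  obtain ⟨σ, s, hs, hσ⟩ := hπ.exists_perm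
  refine Matrix.mulVec_surjective_iff_isUnit.mp fun u => ⟨fun j => s (σ.symm j) * u (σ.symm j), ?_⟩
  funext i
  rw [hσ, Equiv.symm_apply_apply, ← mul_assoc, ← abs_mul_abs_self, hs, one_mul, one_mul]

theorem mulVec_inv_mulVec (hπ : IsSignedPerm π) (u : Fin n → ℝ) :
    π.mulVec (π⁻¹.mulVec u) = u := by
  rw [Matrix.mulVec_mulVec, Matrix.mul_nonsing_inv _ ((Matrix.isUnit_iff_isUnit_det _).mp hπ.isUnit),
    Matrix.one_mulVec]

/-- Signed permutation matrices preserve Euclidean distances. -/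
theorem sum_sq_mulVec_sub (hπ : IsSignedPerm π) (x y : Fin n → ℝ) :
    ∑ i, (π.mulVec x i - π.mulVec y i) ^ 2 = ∑ i, (x i - y i) ^ 2 := by
  obtain ⟨σ, s, hs, hσ⟩ := hπ.exists_perm
  rw [← Equiv.sum_comp σ fun i => (x i - y i) ^ 2]
  refine Finset.sum_congr rfl fun i _ => ?_
  rw [hσ, hσ, ← mul_sub, mul_pow, ← sq_abs (s i), hs, one_pow, one_mul]

theorem absDown_inv_mulVec (hπ : IsSignedPerm π) {u : Fin n → ℝ} (hu : Antitone u)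
    (hu0 : ∀ i, 0 ≤ u i) : absDown (π⁻¹.mulVec u) = u := by
  obtain ⟨σ, s, hs, hσ⟩ := hπ.exists_perm
  refine absDown_eq_of_antitone hu σ fun i => ?_
  have hi := hσ (π⁻¹.mulVec u) i
  rw [hπ.mulVec_inv_mulVec] at hi
  rw [← abs_of_nonneg (hu0 i), hi, abs_mul, hs, one_mul]

end IsSignedPerm

/-- If `π` is a signed permutation with `πy = |y|^↓` and `u` minimizes
`½‖x - πy‖² + ⟨λ, x⟩` over the monotone nonnegative cone, then `π⁻¹u` minimizes
`½‖x - y‖² + κ_λ(x)` over `ℝⁿ`. -/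
theorem stmt5 {n : ℕ} (lam : Fin n → ℝ) (hmono : Antitone lam) (hpos : ∀ i, 0 ≤ lam i)
    (y : Fin n → ℝ) (π : Matrix (Fin n) (Fin n) ℝ) (hπ : IsSignedPerm π)
    (hsort : π.mulVec y = absDown y)
    (u : Fin n → ℝ) (huK : Antitone u ∧ ∀ i, 0 ≤ u i)
    (hmin : ∀ x : Fin n → ℝ, (Antitone x ∧ ∀ i, 0 ≤ x i) →
      (1 / 2) * ∑ i, (u i - π.mulVec y i) ^ 2 + ∑ i, lam i * u i ≤
        (1 / 2) * ∑ i, (x i - π.mulVec y i) ^ 2 + ∑ i, lam i * x i) :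
    ∀ x : Fin n → ℝ,
      (1 / 2) * ∑ i, (π⁻¹.mulVec u i - y i) ^ 2 + kappa lam (π⁻¹.mulVec u) ≤
        (1 / 2) * ∑ i, (x i - y i) ^ 2 + kappa lam x := by
  intro x
  have hx := hmin (absDown x) ⟨absDown_antitone x, absDown_nonneg x⟩
  have hdist := hπ.sum_sq_mulVec_sub (π⁻¹.mulVec u) y
  rw [hπ.mulVec_inv_mulVec] at hdist
  rw [hdist, hsort] at hx
  rw [kappa, hπ.absDown_inv_mulVec huK.1 huK.2, kappa]
  linarith [sum_sq_absDown_sub_le x y]
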